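/- Let T be a triangulation of the completed ∞-gon and n ∈ ℤ. If the Prüfer curve π_n belongs to T, T contains a right fountain at n, and there is no k < n with π_k ∈ T, then the adic curve α_n belongs to T. Dually, if α_n ∈ T, T contains a left fountain at n, and there is no l > n with α_l ∈ T, then π_n ∈ T. -/

import Mathlib

open scoped Classical

/-- Vertices of the completed ∞-gon: `ℤ ∪ {−∞, +∞}` with the extended linear order. -/
abbrev Vtx : Type := WithBot (WithTop ℤ)

/-- The vertex corresponding to an integer. -/
def vInt (m : ℤ) : Vtx := ((m : WithTop ℤ) : Vtx)

/-- The vertex `+∞`. -/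
def vTop : Vtx := ((⊤ : WithTop ℤ) : Vtx)

/-- The vertex `−∞`. -/
def vBot : Vtx := (⊥ : Vtx)

/-- An arc of the completed ∞-gon: a pair of vertices `src < tgt` such that if both
endpoints are integers then they differ by at least `2`. -/
structure Arc where
  src : Vtx
  tgt : Vtx
  lt : src < tgt
  sep : ∀ m n : ℤ, src = vInt m → tgt = vInt n → m + 2 ≤ n

/-- Two arcs `(a,b)` and `(c,d)` cross if `a < c < b < d` or `c < a < d < b`. -/
def Cross (x y : Arc) : Prop :=
  (x.src < y.src ∧ y.src < x.tgt ∧ x.tgt < y.tgt) ∨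
  (y.src < x.src ∧ x.src < y.tgt ∧ y.tgt < x.tgt)

/-- A triangulation of the completed ∞-gon: a maximal set of pairwise compatible
(= non-crossing) arcs. -/
def IsTriangulation (T : Set Arc) : Prop :=
  (∀ x ∈ T, ∀ y ∈ T, ¬ Cross x y) ∧
  ∀ γ : Arc, (∀ x ∈ T, ¬ Cross γ x) → γ ∈ T

lemma vInt_lt_vTop (m : ℤ) : vInt m < vTop := by
  simpa [vInt, vTop] using WithBot.coe_lt_coe.mpr (WithTop.coe_lt_top (m : ℤ))

lemma vBot_lt_vInt (m : ℤ) : vBot < vInt m := WithBot.bot_lt_coe _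

lemma vBot_lt_vTop : vBot < vTop := WithBot.bot_lt_coe _

lemma vTop_ne_vInt (n : ℤ) : vTop ≠ vInt n := by simp [vTop, vInt]

lemma vBot_ne_vInt (n : ℤ) : vBot ≠ vInt n := by simp [vBot, vInt]

/-- The Prüfer curve `π_m = (m, +∞)`. -/
def prufer (m : ℤ) : Arc :=
  ⟨vInt m, vTop, vInt_lt_vTop m, fun _ n _ h => absurd h (vTop_ne_vInt n)⟩

/-- The adic curve `α_m = (−∞, m)`. -/
def adic (m : ℤ) : Arc :=
  ⟨vBot, vInt m, vBot_lt_vInt m, fun k _ h _ => absurd h (vBot_ne_vInt k)⟩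

/-- The generic curve `z = (−∞, +∞)`. -/
def generic : Arc :=
  ⟨vBot, vTop, vBot_lt_vTop, fun k _ h _ => absurd h (vBot_ne_vInt k)⟩

/-- `T` contains an arc with endpoints `x` and `y`. -/
def HasArc (T : Set Arc) (x y : Vtx) : Prop := ∃ γ ∈ T, γ.src = x ∧ γ.tgt = y

/-- `T` has a right fountain at the integer `n`. -/
def RightFountainInt (T : Set Arc) (n : ℤ) : Prop :=
  {p : ℤ | HasArc T (vInt n) (vInt p)}.Infinite

/-- `T` has a left fountain at the integer `n`. -/
def LeftFountainInt (T : Set Arc) (n : ℤ) : Prop :=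
  {p : ℤ | HasArc T (vInt p) (vInt n)}.Infinite

/-- `T` has a right fountain at the vertex `v`. -/
def RightFountain (T : Set Arc) (v : Vtx) : Prop :=
  (∃ n : ℤ, v = vInt n ∧ RightFountainInt T n) ∨
  (v = vTop ∧ {p : ℤ | 0 ≤ p ∧ prufer p ∈ T}.Infinite) ∨
  (v = vBot ∧ {p : ℤ | 0 ≤ p ∧ adic p ∈ T}.Infinite)

/-- `T` has a left fountain at the vertex `v`. -/
def LeftFountain (T : Set Arc) (v : Vtx) : Prop :=
  (∃ n : ℤ, v = vInt n ∧ LeftFountainInt T n) ∨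
  (v = vTop ∧ {p : ℤ | p ≤ 0 ∧ prufer p ∈ T}.Infinite) ∨
  (v = vBot ∧ {p : ℤ | p ≤ 0 ∧ adic p ∈ T}.Infinite)

/-- `T` is locally finite if every vertex is an endpoint of only finitely many arcs of `T`. -/
def LocallyFin (T : Set Arc) : Prop :=
  ∀ v : Vtx, {γ | γ ∈ T ∧ (γ.src = v ∨ γ.tgt = v)}.Finite

/-- An arc is peripheral if both endpoints are integers. -/
def IsPeripheral (γ : Arc) : Prop :=
  (∃ m : ℤ, γ.src = vInt m) ∧ ∃ n : ℤ, γ.tgt = vInt n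

/-- `γ'` is an exchange partner for `γ` relative to `T`:
it is distinct from `γ` and `(T \ {γ}) ∪ {γ'}` is again a triangulation. -/
def MutExchange (T : Set Arc) (γ γ' : Arc) : Prop :=
  γ' ≠ γ ∧ IsTriangulation ((T \ {γ}) ∪ {γ'})

/-- `γ` is a mutable arc of `T`. -/
def IsMutable (T : Set Arc) (γ : Arc) : Prop :=
  γ ∈ T ∧ ∃ γ', MutExchange T γ γ'

/-- The (unique) replacement arc of `γ` in `T`, when `γ` is mutable. -/
noncomputable def flipArc (T : Set Arc) (γ : Arc) : Arc :=
  if h : ∃ γ', MutExchange T γ γ' then h.choose else γ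

/-- The mutation `μ_γ(T)` of `T` at `γ`. -/
noncomputable def mutate (T : Set Arc) (γ : Arc) : Set Arc :=
  (T \ {γ}) ∪ {flipArc T γ}

/-- `μ_γ(δ)`: the effect of the mutation of `T` at `γ` on the arc `δ`. -/
noncomputable def mutArc (T : Set Arc) (γ δ : Arc) : Arc :=
  if δ = γ then flipArc T γ else δ

/-- One step of a mutation sequence on a set of arcs (`none` = no entry). -/
noncomputable def stepT (T : Set Arc) : Option Arc → Set Arc
  | none => T
  | some γ => mutate T γ

/-- One step of a mutation sequence on a single arc. -/
noncomputable def stepA (T : Set Arc) : Option Arc → Arc → Arc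
  | none, δ => δ
  | some γ, δ => mutArc T γ δ

/-- `iterT T θ k` is `μ_{θ_k} ∘ ⋯ ∘ μ_{θ_1}(T)`. Sequences (finite or infinite) are
encoded as `θ : ℕ → Option Arc` whose support is downward closed. -/
noncomputable def iterT (T : Set Arc) (θ : ℕ → Option Arc) : ℕ → Set Arc
  | 0 => T
  | k + 1 => stepT (iterT T θ k) (θ k)

/-- `iterA T θ γ k` is `μ_{θ_k} ∘ ⋯ ∘ μ_{θ_1}(γ)`. -/
noncomputable def iterA (T : Set Arc) (θ : ℕ → Option Arc) (γ : Arc) : ℕ → Arc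
  | 0 => γ
  | k + 1 => stepA (iterT T θ k) (θ k) (iterA T θ γ k)

/-- `θ` is a `T`-admissible sequence: its support is downward closed (so it is a genuine
finite or infinite sequence), each entry is mutable in the triangulation obtained by the
previous mutations, and the mutation of each arc of `T` along `θ` eventually stabilizes. -/
def Admissible (T : Set Arc) (θ : ℕ → Option Arc) : Prop :=
  (∀ i, θ i = none → θ (i + 1) = none) ∧
  (∀ i γ, θ i = some γ → IsMutable (iterT T θ i) γ) ∧
  (∀ γ ∈ T, ∃ l, ∀ k, l ≤ k → iterA T θ γ k = iterA T θ γ l)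

/-- `μ_θ(γ)`: the stable value of the mutation of the arc `γ` along the sequence `θ`. -/
noncomputable def seqLimit (T : Set Arc) (θ : ℕ → Option Arc) (γ : Arc) : Arc :=
  if h : ∃ l, ∀ k, l ≤ k → iterA T θ γ k = iterA T θ γ l
  then iterA T θ γ h.choose else γ

/-- `μ_θ(T)`: the mutation of `T` along the sequence `θ`. -/
noncomputable def mutSeq (T : Set Arc) (θ : ℕ → Option Arc) : Set Arc :=
  seqLimit T θ '' T

/-- The sequence `θ` leaves the arc `γ` untouched. -/
def Untouched (T : Set Arc) (θ : ℕ → Option Arc) (γ : Arc) : Prop :=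
  ∀ l, iterA T θ γ l = γ

/-- The quadrilateral `S(γ)` of a mutable arc `γ` in `T`: with `v₁ < v₂ < v₃ < v₄` the four
endpoints of the two diagonals `γ` and `flipArc T γ`, it consists of those of the pairs
`(v₁,v₂), (v₂,v₃), (v₃,v₄), (v₁,v₄)` that are arcs. -/
noncomputable def quad (T : Set Arc) (γ : Arc) : Set Arc :=
  let γ' := flipArc T γ
  let vs : Vtx × Vtx × Vtx × Vtx :=
    if γ.src < γ'.src then (γ.src, γ'.src, γ.tgt, γ'.tgt) else (γ'.src, γ.src, γ'.tgt, γ.tgt)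
  {δ : Arc | (δ.src = vs.1 ∧ δ.tgt = vs.2.1) ∨ (δ.src = vs.2.1 ∧ δ.tgt = vs.2.2.1) ∨
    (δ.src = vs.2.2.1 ∧ δ.tgt = vs.2.2.2) ∨ (δ.src = vs.1 ∧ δ.tgt = vs.2.2.2)}

/-- The set `𝒫` of Prüfer curves compatible with every arc of `S`. -/
def pruferCompletion (S : Set Arc) : Set Arc :=
  {γ | (∃ k : ℤ, γ = prufer k) ∧ ∀ x ∈ S, ¬ Cross γ x}

/-- The set `𝒜̃` of adic curves compatible with every arc of `S ∪ 𝒫(S)`. -/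
def adicCompletion' (S : Set Arc) : Set Arc :=
  {γ | (∃ k : ℤ, γ = adic k) ∧ ∀ x ∈ S ∪ pruferCompletion S, ¬ Cross γ x}

/-- The completed (Prüfer) mutation `μ̄_θ(T) = μ_θ(T) ∪ 𝒫 ∪ 𝒜̃` of `T` along `θ`. -/
noncomputable def completedMut (T : Set Arc) (θ : ℕ → Option Arc) : Set Arc :=
  mutSeq T θ ∪ pruferCompletion (mutSeq T θ) ∪ adicCompletion' (mutSeq T θ)

/-- The tower of triangulations associated to a composition of completed mutations. -/
noncomputable def compIter (T : Set Arc) (Θ : ℕ → Option (ℕ → Option Arc)) : ℕ → Set Arc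
  | 0 => T
  | k + 1 =>
    match Θ k with
    | none => compIter T Θ k
    | some θ => completedMut (compIter T Θ k) θ

/-- `Θ` is a `T`-admissible composition of completed mutations. -/
def CompAdmissible (T : Set Arc) (Θ : ℕ → Option (ℕ → Option Arc)) : Prop :=
  (∀ i, Θ i = none → Θ (i + 1) = none) ∧
  ∀ i θ, Θ i = some θ → Admissible (compIter T Θ i) θ

/-- The transfinite mutation of `T` along the composition `Θ`. -/
noncomputable def transfiniteMut (T : Set Arc) (Θ : ℕ → Option (ℕ → Option Arc)) : Set Arc :=
  ⋃ i, {γ ∈ compIter T Θ i |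
    ∀ k, i ≤ k → ∀ θ, Θ k = some θ → Untouched (compIter T Θ k) θ γ}

lemma vtx_cases (v : Vtx) : v = vBot ∨ v = vTop ∨ ∃ m : ℤ, v = vInt m := by
  induction v using WithBot.recBotCoe with
  | bot => exact Or.inl rfl
  | coe v =>
    induction v using WithTop.recTopCoe with
    | top => exact Or.inr (Or.inl rfl)
    | coe m => exact Or.inr (Or.inr ⟨m, rfl⟩)

lemma vInt_lt_vInt (a b : ℤ) : vInt a < vInt b ↔ a < b := by
  simp [vInt]

lemma arc_ext (x y : Arc) (h1 : x.src = y.src) (h2 : x.tgt = y.tgt) : x = y := by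
  cases x; cases y; cases h1; cases h2; rfl

lemma exists_far_right (T : Set Arc) (n : ℤ) (h : RightFountainInt T n) (d : ℤ) :
    ∃ p : ℤ, d < p ∧ HasArc T (vInt n) (vInt p) := by
  by_contra hc
  push Not at hc
  refine h ((Set.finite_Icc n d).subset ?_)
  intro p hp
  refine ⟨?_, not_lt.mp fun hlt => hc p hlt hp⟩
  obtain ⟨γ, -, h1, h2⟩ := hp
  have := γ.sep n p h1 h2
  omega

lemma exists_far_left (T : Set Arc) (n : ℤ) (h : LeftFountainInt T n) (d : ℤ) :
    ∃ p : ℤ, p < d ∧ HasArc T (vInt p) (vInt n) := by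
  by_contra hc
  push Not at hc
  refine h ((Set.finite_Icc d n).subset ?_)
  intro p hp
  refine ⟨not_lt.mp fun hlt => hc p hlt hp, ?_⟩
  obtain ⟨γ, -, h1, h2⟩ := hp
  have := γ.sep p n h1 h2
  omega

/-- If `π_n ∈ T`, `T` has a right fountain at `n`, and there is no `k < n` with `π_k ∈ T`,
then `α_n ∈ T`; dually for adic curves. -/
theorem statement3 (T : Set Arc) (hT : IsTriangulation T) (n : ℤ) :
    (prufer n ∈ T → RightFountainInt T n → (∀ k : ℤ, k < n → prufer k ∉ T) → adic n ∈ T) ∧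
    (adic n ∈ T → LeftFountainInt T n → (∀ l : ℤ, n < l → adic l ∉ T) → prufer n ∈ T) := by
  constructor
  · intro _ hF hno
    refine hT.2 _ fun x hx hc => ?_
    rcases hc with ⟨h1, h2, h3⟩ | ⟨h1, _, _⟩
    · change vBot < x.src at h1
      change x.src < vInt n at h2
      change vInt n < x.tgt at h3
      rcases vtx_cases x.src with hs | hs | ⟨c, hs⟩
      · exact absurd hs h1.ne'
      · exact absurd (hs ▸ h2) (vInt_lt_vTop n).not_gt
      · rcases vtx_cases x.tgt with ht | ht | ⟨d, ht⟩
        · exact absurd (ht ▸ h3) (vBot_lt_vInt n).not_gt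
        · refine hno c ((vInt_lt_vInt _ _).1 (hs ▸ h2)) ?_
          rw [← arc_ext x (prufer c) hs ht]
          exact hx
        · obtain ⟨p, hp, γ, hγ, g1, g2⟩ := exists_far_right T n hF d
          refine hT.1 x hx γ hγ (Or.inl ⟨?_, ?_, ?_⟩)
          · rw [g1]; exact h2
          · rw [g1]; exact h3
          · rw [g2, ht]; exact (vInt_lt_vInt _ _).2 hp
    · exact not_lt_bot h1
  · intro _ hF hno
    refine hT.2 _ fun x hx hc => ?_
    rcases hc with ⟨_, _, h3⟩ | ⟨h1, h2, h3⟩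
    · change vTop < x.tgt at h3
      exact not_top_lt h3
    · change x.src < vInt n at h1
      change vInt n < x.tgt at h2
      change x.tgt < vTop at h3
      rcases vtx_cases x.tgt with ht | ht | ⟨d, ht⟩
      · exact absurd (ht ▸ h2) (vBot_lt_vInt n).not_gt
      · exact absurd ht h3.ne
      · rcases vtx_cases x.src with hs | hs | ⟨c, hs⟩
        · refine hno d ((vInt_lt_vInt _ _).1 (ht ▸ h2)) ?_
          rw [← arc_ext x (adic d) hs ht]
          exact hx
        · exact absurd (hs ▸ h1) (vInt_lt_vTop n).not_gt
        · obtain ⟨p, hp, γ, hγ, g1, g2⟩ := exists_far_left T n hF c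
          refine hT.1 x hx γ hγ (Or.inr ⟨?_, ?_, ?_⟩)
          · rw [g1, hs]; exact (vInt_lt_vInt _ _).2 hp
          · rw [g2]; exact h1
          · rw [g2]; exact h2
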